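/- Let G be the simple graph on six vertices v1,...,v6 whose edges are the cycle edges v1v2, v2v3, v3v4, v4v5, v5v6, v6v1 together with the chords v1v3, v1v5, v2v4 and v4v6 (this is the graph G^6_137 in Harary's enumeration of six-vertex graphs). Then for every integer n ≥ 1, the crossing number of the Cartesian product G □ P_n equals 4n. -/

import Mathlib

open SimpleGraph

/-- A drawing of a simple graph in the plane: vertices are mapped to distinct
points, and each edge is mapped to a simple arc (parametrised by `[0,1]`)
joining the images of its endpoints and avoiding the images of all vertices
in its interior. -/
structure Drawing {V : Type*} (G : SimpleGraph V) where
  vertexMap : V → ℝ × ℝ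
  vertexMap_injective : Function.Injective vertexMap
  arc : G.edgeSet → ℝ → ℝ × ℝ
  arc_continuousOn : ∀ e, ContinuousOn (arc e) (Set.Icc 0 1)
  arc_injOn : ∀ e, Set.InjOn (arc e) (Set.Icc 0 1)
  arc_endpoints : ∀ e : G.edgeSet, ∃ u v : V,
    (e : Sym2 V) = s(u, v) ∧ arc e 0 = vertexMap u ∧ arc e 1 = vertexMap v
  arc_avoids_vertices : ∀ e : G.edgeSet, ∀ t ∈ Set.Ioo (0 : ℝ) 1, ∀ w : V,
    arc e t ≠ vertexMap w

/-- The crossings of a drawing: an unordered pair of distinct edges together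
with a point of the plane where the two corresponding arcs intersect away
from their endpoints. -/
def Drawing.crossings {V : Type*} {G : SimpleGraph V} (D : Drawing G) :
    Set (Sym2 G.edgeSet × (ℝ × ℝ)) :=
  { x | ∃ e f : G.edgeSet, e ≠ f ∧ x.1 = s(e, f) ∧
      (∃ s ∈ Set.Ioo (0 : ℝ) 1, D.arc e s = x.2) ∧
      (∃ t ∈ Set.Ioo (0 : ℝ) 1, D.arc f t = x.2) }

/-- The crossing number of a simple graph: the minimum number of crossings
over all drawings of the graph in the plane. -/
noncomputable def crossingNumber {V : Type*} (G : SimpleGraph V) : ℕ :=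
  sInf { n : ℕ | ∃ D : Drawing G, D.crossings.Finite ∧ D.crossings.ncard = n }

/-- The graph `G⁶₁₃₇`: the 6-cycle `v1 v2 v3 v4 v5 v6` together with the
chords `v1v3`, `v1v5`, `v2v4` and `v4v6`. -/
def G6_137 : SimpleGraph (Fin 6) :=
  SimpleGraph.fromEdgeSet
    {s(0, 1), s(1, 2), s(2, 3), s(3, 4), s(4, 5), s(5, 0), s(0, 2), s(0, 4), s(1, 3), s(3, 5)}

/-- The total change over `[0,1]` of a continuous logarithm of `h`. -/
noncomputable def logChange (h : ℝ → ℂ) : ℂ :=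
  open Classical in
  if H : ∃ f : ℝ → ℂ, Continuous f ∧ ∀ s, Complex.exp (f s) = h s then
    H.choose 1 - H.choose 0 else 0

lemma exists_continuous_log {E : Type*} [NormedAddCommGroup E] [NormedSpace ℝ E] {h : E → ℂ}
    (hc : Continuous h) (h0 : ∀ x, h x ≠ 0) :
    ∃ f : E → ℂ, Continuous f ∧ ∀ x, Complex.exp (f x) = h x := by
  obtain ⟨f, ⟨-, hf⟩, -⟩ := Complex.isCoveringMapOn_exp.existsUnique_continuousMap_lifts
    ⟨h, hc⟩ (a₀ := 0) (Complex.exp_log (h0 0)) h0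
  exact ⟨f, f.continuous, congrFun hf⟩

lemma sub_eq_sub_of_exp_eq {f g : ℝ → ℂ} (hf : Continuous f) (hg : Continuous g) {c : ℂ}
    (h : ∀ s, Complex.exp (f s) = c * Complex.exp (g s)) : f 1 - f 0 = g 1 - g 0 := by
  have key : f = fun s => g s + (f 0 - g 0) := by
    refine Complex.isCoveringMap_exp.eq_of_comp_eq hf (by fun_prop) ?_ 0 (by simp)
    funext s
    apply Subtype.ext
    have h0 := h 0
    have : c = Complex.exp (f 0 - g 0) := by
      rw [Complex.exp_sub, h0, mul_div_cancel_right₀ _ (Complex.exp_ne_zero _)]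
    simp only [Function.comp_apply, h s, Complex.exp_add, ← this, mul_comm]
  rw [congrFun key 1]
  ring

lemma logChange_eq {h f : ℝ → ℂ} (hf : Continuous f) {c : ℂ} (hc : c ≠ 0)
    (h' : ∀ s, Complex.exp (f s) = c * h s) : logChange h = f 1 - f 0 := by
  have H : ∃ f : ℝ → ℂ, Continuous f ∧ ∀ s, Complex.exp (f s) = h s :=
    ⟨fun s => f s - Complex.log c, by fun_prop, fun s => by
      rw [Complex.exp_sub, h', Complex.exp_log hc, mul_div_cancel_left₀ _ hc]⟩
  rw [logChange, dif_pos H]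
  exact (sub_eq_sub_of_exp_eq hf H.choose_spec.1 (c := c)
    (fun s => by rw [h', H.choose_spec.2])).symm

lemma exp_logChange {h : ℝ → ℂ} (hc : Continuous h) (h0 : ∀ x, h x ≠ 0) :
    Complex.exp (logChange h) = h 1 / h 0 := by
  obtain ⟨f, hf, hfe⟩ := exists_continuous_log hc h0
  rw [logChange_eq hf one_ne_zero (by simpa using hfe), Complex.exp_sub, hfe, hfe]

lemma logChange_add_eq_of_disjoint {p q : ℝ → ℂ} (hp : Continuous p) (hq : Continuous q)
    (hpq : ∀ s t, p s ≠ q t) :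
    logChange (fun s => p s - q 0) + logChange (fun t => q t - p 1) =
      logChange (fun t => q t - p 0) + logChange (fun s => p s - q 1) := by
  obtain ⟨f, hf, hfe⟩ := exists_continuous_log (E := ℝ × ℝ) (h := fun x => p x.1 - q x.2)
    (by fun_prop) (fun x => sub_ne_zero.mpr (hpq _ _))
  rw [logChange_eq (h := fun s => p s - q 0) (f := fun s => f (s, 0))
      (by fun_prop) one_ne_zero (by simp [hfe]),
    logChange_eq (h := fun s => p s - q 1) (f := fun s => f (s, 1))
      (by fun_prop) one_ne_zero (by simp [hfe]),
    logChange_eq (h := fun t => q t - p 0) (f := fun t => f (0, t)) (c := -1)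
      (by fun_prop) (by simp) (by simp [hfe]),
    logChange_eq (h := fun t => q t - p 1) (f := fun t => f (1, t)) (c := -1)
      (by fun_prop) (by simp) (by simp [hfe])]
  ring

lemma exists_int_logChange {h : ℝ → ℂ} (hc : Continuous h) (h0 : ∀ x, h x ≠ 0) {a b : ℂ}
    (ha : Complex.exp a = h 0) (hb : Complex.exp b = h 1) :
    ∃ k : ℤ, logChange h = b - a + k * (2 * Real.pi * Complex.I) := by
  apply Complex.exp_eq_exp_iff_exists_int.mp
  rw [exp_logChange hc h0, Complex.exp_sub, ha, hb]

lemma exists_int_log_neg {z : ℂ} (hz : z ≠ 0) :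
    ∃ k : ℤ, Complex.log (-z) = Complex.log z + (2 * k + 1) * (Real.pi * Complex.I) := by
  obtain ⟨k, hk⟩ := Complex.exp_eq_exp_iff_exists_int.mp
    (show Complex.exp (Complex.log (-z)) = Complex.exp (Complex.log z + Real.pi * Complex.I) by
      rw [Complex.exp_log (neg_ne_zero.mpr hz), Complex.exp_add, Complex.exp_log hz,
        Complex.exp_pi_mul_I]; ring)
  exact ⟨k, by rw [hk]; ring⟩

/-- The complete bipartite graph `K₃,₃` is not planar. -/
theorem exists_meet_of_curves {a x : Fin 3 → ℂ} {γ : Fin 3 → Fin 3 → ℝ → ℂ}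
    (hc : ∀ i j, Continuous (γ i j)) (h0 : ∀ i j, γ i j 0 = a i) (h1 : ∀ i j, γ i j 1 = x j) :
    ∃ i i' j j' s t, i ≠ i' ∧ j ≠ j' ∧ γ i j s = γ i' j' t := by
  by_contra! H
  have hne : ∀ j : Fin 3, ∃ j' : Fin 3, j ≠ j' := by decide
  have va : ∀ i i' j s, i ≠ i' → γ i j s - a i' ≠ 0 := fun i i' j s h => by
    obtain ⟨j', hj⟩ := hne j
    rw [← h0 i' j']
    exact sub_ne_zero.mpr (H i i' j j' s 0 h hj)
  have vx : ∀ i j j' s, j ≠ j' → γ i j s - x j' ≠ 0 := fun i j j' s h => by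
    obtain ⟨i', hi⟩ := hne i
    rw [← h1 i' j']
    exact sub_ne_zero.mpr (H i i' j j' s 1 hi h)
  have hA : ∀ i i', i ≠ i' → a i - a i' ≠ 0 := fun i i' h => by
    simpa [h0] using va i i' 0 0 h
  have hX : ∀ j j', j ≠ j' → x j - x j' ≠ 0 := fun j j' h => by
    simpa [h1] using vx 0 j j' 1 h
  have hB : ∀ i j, x j - a i ≠ 0 := fun i j => by
    obtain ⟨i', hi⟩ := hne i
    simpa [h1] using va i' i j 1 hi.symm
  have hα : ∀ i i', ∃ k : ℤ, i ≠ i' →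
      Complex.log (a i' - a i) = Complex.log (a i - a i') + (2 * k + 1) * (Real.pi * Complex.I) := by
    intro i i'
    by_cases h : i = i'
    · exact ⟨0, fun h' => absurd h h'⟩
    · obtain ⟨k, hk⟩ := exists_int_log_neg (hA i i' h)
      exact ⟨k, fun _ => by rw [← hk, neg_sub]⟩
  have hξ : ∀ j j', ∃ k : ℤ, j ≠ j' →
      Complex.log (x j' - x j) = Complex.log (x j - x j') + (2 * k + 1) * (Real.pi * Complex.I) := by
    intro i i'
    by_cases h : i = i'
    · exact ⟨0, fun h' => absurd h h'⟩
    · obtain ⟨k, hk⟩ := exists_int_log_neg (hX i i' h)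
      exact ⟨k, fun _ => by rw [← hk, neg_sub]⟩
  have hu : ∀ i j i', ∃ k : ℤ, i ≠ i' → logChange (fun s => γ i j s - a i') =
      Complex.log (x j - a i') - Complex.log (a i - a i') + k * (2 * Real.pi * Complex.I) := by
    intro i j i'
    by_cases h : i = i'
    · exact ⟨0, fun h' => absurd h h'⟩
    · obtain ⟨k, hk⟩ := exists_int_logChange (h := fun s => γ i j s - a i')
        (by have := hc i j; fun_prop) (fun s => va i i' j s h)
        (a := Complex.log (a i - a i')) (b := Complex.log (x j - a i'))
        (by rw [Complex.exp_log (hA i i' h), h0]) (by rw [Complex.exp_log (hB i' j), h1])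
      exact ⟨k, fun _ => hk⟩
  have hw : ∀ i j j', ∃ k : ℤ, j ≠ j' → logChange (fun s => γ i j s - x j') =
      Complex.log (x j - x j') - (Complex.log (x j' - a i) + Real.pi * Complex.I)
        + k * (2 * Real.pi * Complex.I) := by
    intro i j j'
    by_cases h : j = j'
    · exact ⟨0, fun h' => absurd h h'⟩
    · obtain ⟨k, hk⟩ := exists_int_logChange (h := fun s => γ i j s - x j')
        (by have := hc i j; fun_prop) (fun s => vx i j j' s h)
        (a := Complex.log (x j' - a i) + Real.pi * Complex.I) (b := Complex.log (x j - x j'))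
        (by rw [Complex.exp_add, Complex.exp_log (hB i j'), h0, Complex.exp_pi_mul_I]; ring)
        (by rw [Complex.exp_log (hX j j' h), h1])
      exact ⟨k, fun _ => hk⟩
  choose α hα using hα
  choose ξ hξ using hξ
  choose u hu using hu
  choose w hw using hw
  have hπ : (Real.pi * Complex.I : ℂ) ≠ 0 :=
    mul_ne_zero (Complex.ofReal_ne_zero.mpr Real.pi_ne_zero) Complex.I_ne_zero
  have hξ' : ∀ j j', j ≠ j' → ξ j j' + ξ j' j + 1 = 0 := fun j j' h => by
    have e1 := hξ j j' h
    have e2 := hξ j' j h.symm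
    have : ((ξ j j' + ξ j' j + 1 : ℤ) : ℂ) * (Real.pi * Complex.I) = 0 := by
      push_cast
      linear_combination (-e1 - e2) / 2
    exact_mod_cast (mul_eq_zero.mp this).resolve_right hπ
  have key : ∀ i i' j j', i ≠ i' → j ≠ j' →
      α i i' + ξ j j' + 1 + u i j i' + w i' j' j - u i' j' i - w i j j' = 0 := by
    intro i i' j j' hi hj
    have e := logChange_add_eq_of_disjoint (hc i j) (hc i' j') (fun s t => H i i' j j' s t hi hj)
    rw [h0, h1, h0, h1, hu i j i' hi, hw i' j' j hj.symm, hu i' j' i hi.symm, hw i j j' hj] at e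
    have e1 := hα i i' hi
    have e2 := hξ j j' hj
    have : ((α i i' + ξ j j' + 1 + u i j i' + w i' j' j - u i' j' i - w i j j' : ℤ) : ℂ) *
        (Real.pi * Complex.I) = 0 := by
      push_cast
      linear_combination (e - e1 - e2) / 2
    exact_mod_cast (mul_eq_zero.mp this).resolve_right hπ
  have n01 : (0 : Fin 3) ≠ 1 := by decide
  have n02 : (0 : Fin 3) ≠ 2 := by decide
  have n12 : (1 : Fin 3) ≠ 2 := by decide
  have both : ∀ i i', i ≠ i' → ∀ j j', j ≠ j' → 2 * α i i' + 1
      + (u i j i' + w i' j' j - u i' j' i - w i j j')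
      + (u i j' i' + w i' j j' - u i' j i - w i j' j) = 0 := fun i i' hi j j' hj => by
    have e1 := key i i' j j' hi hj
    have e2 := key i i' j' j hi hj.symm
    have e3 := hξ' j j' hj
    omega
  have p01 := both 0 1 n01
  have p02 := both 0 2 n02
  have p12 := both 1 2 n12
  have := p01 0 1 n01
  have := p01 0 2 n02
  have := p01 1 2 n12
  have := p02 0 1 n01
  have := p02 0 2 n02
  have := p02 1 2 n12
  have := p12 0 1 n01
  have := p12 0 2 n02
  have := p12 1 2 n12
  omega

/-- If nine sets contain paths joining three points `a i` to three points `x j`, then two of them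
belonging to distinct `i` and distinct `j` meet. -/
theorem exists_inter_nonempty_of_joinedIn {a x : Fin 3 → ℝ × ℝ} {F : Fin 3 → Fin 3 → Set (ℝ × ℝ)}
    (h : ∀ i j, JoinedIn (F i j) (a i) (x j)) :
    ∃ i i' j j', i ≠ i' ∧ j ≠ j' ∧ (F i j ∩ F i' j').Nonempty := by
  obtain ⟨i, i', j, j', s, t, hi, hj, e⟩ := exists_meet_of_curves
    (γ := fun i j s => Complex.equivRealProdCLM.symm ((h i j).somePath.extend s))
    (a := fun i => Complex.equivRealProdCLM.symm (a i))
    (x := fun j => Complex.equivRealProdCLM.symm (x j))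
    (fun i j => by fun_prop) (by simp) (by simp)
  have mem : ∀ i j s, (h i j).somePath.extend s ∈ F i j := fun i j s =>
    (h i j).somePath_mem _
  refine ⟨i, i', j, j', hi, hj, _, mem i j s, ?_⟩
  rw [Complex.equivRealProdCLM.symm.injective e]
  exact mem i' j' t

/-- Positions `l < p < r` on the ladder divide the positions of a strand into the part from `l`
to `p`, the position `p` itself and the part from `p` to `r`; gap positions are `2` modulo `3`. -/
def arm (l p r : ℕ) : Fin 3 → Set ℕ :=
  ![{q | q = l ∨ q % 3 = 2 ∧ l < q ∧ q < p}, {p}, {q | q = r ∨ q % 3 = 2 ∧ p < q ∧ q < r}]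

/-- The positions `q` and `q'` belong to different arms of the triple `l, p, r`. -/
def Separated (l p r q q' : ℕ) : Prop :=
  ∃ i i', i ≠ i' ∧ q ∈ arm l p r i ∧ q' ∈ arm l p r i'

/-- The position of the `j`-th star. -/
def starPos (j : ℕ) : ℕ := 3 * (j / 2) + j % 2

/-- The lower position of the triple indexed by `t`. -/
def lowPos (t : ℕ × Bool) : ℕ := starPos (if t.2 then t.1 - 1 else t.1 - 2)

/-- The upper position of the triple indexed by `t`. -/
def highPos (n : ℕ) (t : ℕ × Bool) : ℕ :=
  starPos (if t.2 then min (t.1 + 2) (2 * n + 1) else t.1 + 1)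

lemma Separated.symm {l p r q q' : ℕ} (h : Separated l p r q q') : Separated l p r q' q := by
  obtain ⟨i, i', h, h1, h2⟩ := h
  exact ⟨i', i, h.symm, h2, h1⟩

lemma Separated.cases {l p r q q' : ℕ} (h : Separated l p r q q') (hl : l < p) (hr : p < r)
    (hq : q < q') :
    ((q = l ∨ q % 3 = 2 ∧ l < q ∧ q < p) ∧ q' = p) ∨
    (q = p ∧ (q' = r ∨ q' % 3 = 2 ∧ p < q' ∧ q' < r)) ∨
    ((q = l ∨ q % 3 = 2 ∧ l < q ∧ q < p) ∧ (q' = r ∨ q' % 3 = 2 ∧ p < q' ∧ q' < r)) := by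
  obtain ⟨i, i', h, h1, h2⟩ := h
  fin_cases i <;> fin_cases i' <;> simp [arm] at h h1 h2 <;> omega

lemma Separated.ne {l p r q q' : ℕ} (h : Separated l p r q q') (hl : l < p) (hr : p < r) :
    q ≠ q' := by
  obtain ⟨i, i', h, h1, h2⟩ := h
  fin_cases i <;> fin_cases i' <;> simp [arm] at h h1 h2 <;> omega

lemma low_lt {n : ℕ} {t : ℕ × Bool} (h : t.1 ∈ Finset.Icc 1 (2 * n)) :
    lowPos t < starPos t.1 ∧ starPos t.1 < highPos n t := by
  obtain ⟨j, _ | _⟩ := t <;> simp [lowPos, highPos, starPos] at * <;> omega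

/-- The at most two triples separating the positions `3 * L + c` and `3 * L + c + d`. -/
def candidates (n L : ℕ) : ℕ → ℕ → (ℕ × Bool) × (ℕ × Bool)
  | 0, 1 => ((max 1 (2 * L), false), (min (2 * n) (2 * L + 1), true))
  | 0, 2 => (if L = 0 then (1, false) else (2 * L, true), (2 * L + 1, true))
  | 0, 3 => (if L = 0 then (1, false) else (2 * L, true), (2 * L + 2, false))
  | 0, _ => ((2 * L + 1, true), (2 * L + 2, false))
  | 1, 1 => ((2 * L + 1, false), (2 * L + 1, true))
  | 1, 2 => ((2 * L + 1, false), (2 * L + 2, true))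
  | 1, 3 => ((2 * L + 1, true), if L + 1 = n then (2 * L + 2, true) else (2 * L + 3, false))
  | 1, _ => ((2 * L + 2, true), (2 * L + 3, false))
  | _, 1 => ((2 * L + 2, false), (2 * L + 2, true))
  | _, 2 => ((2 * L + 2, false), if L + 1 = n then (2 * L + 2, true) else (2 * L + 3, false))
  | _, _ => ((2 * L + 2, true), (2 * L + 3, false))

lemma mem_candidates {n q d : ℕ} (hd : 0 < d) {t : ℕ × Bool} (ht : t.1 ∈ Finset.Icc 1 (2 * n))
    (h : Separated (lowPos t) (starPos t.1) (highPos n t) q (q + d)) :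
    t = (candidates n (q / 3) (q % 3) d).1 ∨ t = (candidates n (q / 3) (q % 3) d).2 := by
  have h := h.cases (low_lt ht).1 (low_lt ht).2 (by omega)
  rw [Finset.mem_Icc] at ht
  have hq := Nat.div_add_mod q 3
  have hc := Nat.mod_lt q (show 0 < 3 by norm_num)
  generalize q / 3 = L at *
  generalize q % 3 = c at *
  subst hq
  obtain ⟨j, b⟩ := t
  obtain ⟨K, e, he, rfl⟩ : ∃ K e, e < 2 ∧ j = 2 * K + e := ⟨j / 2, j % 2, by omega, by omega⟩
  dsimp only at ht
  have hp : starPos (2 * K + e) = 3 * K + e := by simp only [starPos]; omega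
  have hlo : lowPos (2 * K + e, b) = if b then (if e = 0 then 3 * K - 2 else 3 * K)
      else if e = 0 then 3 * (K - 1) else if K = 0 then 0 else 3 * K - 2 := by
    rcases b <;> interval_cases e <;> simp [lowPos, starPos] <;> grind
  have hhi : highPos n (2 * K + e, b) = if b then (if e = 0 then
      (if K < n then 3 * K + 3 else 3 * K + 1) else 3 * K + 4)
      else if e = 0 then 3 * K + 1 else 3 * K + 3 := by
    rcases b <;> interval_cases e <;> simp [highPos, starPos] <;> grind
  have hd' : d < 6 := by
    rw [hp, hlo, hhi] at h
    interval_cases e <;> rcases b <;> simp at h <;> grind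
  rw [hp, hlo, hhi] at h
  interval_cases e <;> rcases b <;> interval_cases c <;> interval_cases d <;>
    simp [candidates] at h ⊢ <;> grind

lemma highPos_le {n : ℕ} {t : ℕ × Bool} (h : t.1 ∈ Finset.Icc 1 (2 * n)) :
    highPos n t ≤ 3 * n + 1 := by
  obtain ⟨j, _ | _⟩ := t <;> simp [highPos, starPos] at * <;> omega

lemma Separated.le {l p r q q' : ℕ} (h : Separated l p r q q') (hl : l < p) (hr : p < r) :
    q ≤ r ∧ q' ≤ r := by
  obtain ⟨i, i', h, h1, h2⟩ := h
  fin_cases i <;> fin_cases i' <;> simp [arm] at h h1 h2 <;> omega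

/-- The double counting argument: every pair of positions is separated by at most two of the
`4 * n` triples, each of which separates at least two crossing pairs. -/
theorem four_mul_le_card {n : ℕ} {C : Fin 4 × ℕ → Fin 4 × ℕ → Prop}
    (hsymm : ∀ a b, C a b → C b a)
    (hC : ∀ t : ℕ × Bool, t.1 ∈ Finset.Icc 1 (2 * n) → ∀ z : Fin 4, ∃ a b : Fin 4 × ℕ,
      a.1 ≠ b.1 ∧ a.1 ≠ z ∧ b.1 ≠ z ∧ C a b ∧
      Separated (lowPos t) (starPos t.1) (highPos n t) a.2 b.2)
    {X : Finset ((Fin 4 × ℕ) × (Fin 4 × ℕ))}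
    (hX : ∀ a b, a.1 < b.1 → a.2 ≤ 3 * n + 1 → b.2 ≤ 3 * n + 1 → a.2 ≠ b.2 → C a b →
      (a, b) ∈ X) :
    4 * n ≤ X.card := by
  classical
  have above : ∀ t ∈ Finset.Icc 1 (2 * n) ×ˢ (Finset.univ : Finset Bool), 2 ≤
      (X.bipartiteAbove (fun t w => Separated (lowPos t) (starPos t.1) (highPos n t)
        w.1.2 w.2.2) t).card := by
    intro t ht
    replace ht := (Finset.mem_product.mp ht).1
    have key : ∀ z : Fin 4, ∃ w ∈ X.bipartiteAbove (fun t w => Separated (lowPos t)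
        (starPos t.1) (highPos n t) w.1.2 w.2.2) t, w.1.1 ≠ z ∧ w.2.1 ≠ z := by
      intro z
      obtain ⟨a, b, hab, ha, hb, hc, hs⟩ := hC t ht z
      have hle := hs.le (low_lt ht).1 (low_lt ht).2
      have hne := hs.ne (low_lt ht).1 (low_lt ht).2
      have hhi := highPos_le ht
      rcases lt_or_gt_of_ne hab with h | h
      · exact ⟨(a, b), Finset.mem_filter.mpr
          ⟨hX a b h (by omega) (by omega) hne hc, hs⟩, ha, hb⟩
      · exact ⟨(b, a), Finset.mem_filter.mpr
          ⟨hX b a h (by omega) (by omega) hne.symm (hsymm _ _ hc), hs.symm⟩, hb, ha⟩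
    obtain ⟨w, hw, -⟩ := key 0
    obtain ⟨w', hw', h, -⟩ := key w.1.1
    exact Finset.one_lt_card.mpr ⟨w, hw, w', hw', fun e => h (by rw [e])⟩
  have below : ∀ w ∈ X.filter (fun w => w.1.2 ≠ w.2.2),
      ((Finset.Icc 1 (2 * n) ×ˢ (Finset.univ : Finset Bool)).bipartiteBelow
        (fun t w => Separated (lowPos t) (starPos t.1) (highPos n t) w.1.2 w.2.2) w).card ≤ 2 := by
    intro w hw
    have aux : ∀ q q', q < q' → ∃ c₁ c₂ : ℕ × Bool, ∀ t : ℕ × Bool, t.1 ∈ Finset.Icc 1 (2 * n) →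
        Separated (lowPos t) (starPos t.1) (highPos n t) q q' → t = c₁ ∨ t = c₂ := by
      intro q q' h
      obtain ⟨d, rfl⟩ := Nat.exists_eq_add_of_lt h
      exact ⟨_, _, fun t ht hs => mem_candidates (d := d + 1) (by omega) ht hs⟩
    have aux' : ∃ c₁ c₂ : ℕ × Bool, ∀ t : ℕ × Bool, t.1 ∈ Finset.Icc 1 (2 * n) →
        Separated (lowPos t) (starPos t.1) (highPos n t) w.1.2 w.2.2 → t = c₁ ∨ t = c₂ := by
      rcases lt_or_gt_of_ne (Finset.mem_filter.mp hw).2 with h | h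
      · exact aux _ _ h
      · obtain ⟨c₁, c₂, hc⟩ := aux _ _ h
        exact ⟨c₁, c₂, fun t ht hs => hc t ht hs.symm⟩
    obtain ⟨c₁, c₂, hc⟩ := aux'
    refine (Finset.card_le_card (t := {c₁, c₂}) fun t ht => ?_).trans Finset.card_le_two
    obtain ⟨ht, hs⟩ := Finset.mem_filter.mp ht
    simpa using hc t (Finset.mem_product.mp ht).1 hs
  have hcard := Finset.card_mul_le_card_mul
    (s := Finset.Icc 1 (2 * n) ×ˢ (Finset.univ : Finset Bool))
    (t := X.filter (fun w => w.1.2 ≠ w.2.2)) (m := 2) (n := 2) _ (fun t ht => ?_) below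
  · have := Finset.card_filter_le X (fun w => w.1.2 ≠ w.2.2)
    simp only [Finset.card_product, Nat.card_Icc, Finset.card_univ, Fintype.card_bool] at hcard
    omega
  · refine (above t ht).trans (Finset.card_le_card fun w hw => ?_)
    obtain ⟨hw, hs⟩ := Finset.mem_filter.mp hw
    have ht := (Finset.mem_product.mp ht).1
    exact Finset.mem_filter.mpr ⟨Finset.mem_filter.mpr
      ⟨hw, hs.ne (low_lt ht).1 (low_lt ht).2⟩, hs⟩

namespace Drawing

variable {V : Type*} {G : SimpleGraph V} (D : Drawing G)

/-- The closed arc representing an edge. -/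
def trace (e : Sym2 V) : Set (ℝ × ℝ) :=
  {p | ∃ h : e ∈ G.edgeSet, ∃ s ∈ Set.Icc (0 : ℝ) 1, D.arc ⟨e, h⟩ s = p}

lemma joinedIn_trace {u v : V} (h : G.Adj u v) :
    JoinedIn (D.trace s(u, v)) (D.vertexMap u) (D.vertexMap v) := by
  let e : G.edgeSet := ⟨s(u, v), h⟩
  have hj : JoinedIn (D.trace s(u, v)) (D.arc e 0) (D.arc e 1) :=
    JoinedIn.ofLine (D.arc_continuousOn e) rfl rfl (by
      rintro _ ⟨s, hs, rfl⟩
      exact ⟨h, s, hs, rfl⟩)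
  obtain ⟨a, b, hab, ha, hb⟩ := D.arc_endpoints e
  rw [ha, hb] at hj
  rcases Sym2.eq_iff.mp hab with ⟨rfl, rfl⟩ | ⟨rfl, rfl⟩
  · exact hj
  · exact hj.symm

lemma eq_vertexMap_or_mem_Ioo (e : G.edgeSet) {s : ℝ} (hs : s ∈ Set.Icc (0 : ℝ) 1) :
    (∃ v ∈ (e : Sym2 V), D.arc e s = D.vertexMap v) ∨ s ∈ Set.Ioo (0 : ℝ) 1 := by
  obtain ⟨a, b, hab, ha, hb⟩ := D.arc_endpoints e
  rcases eq_or_lt_of_le hs.1 with rfl | h0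
  · exact .inl ⟨a, by simp [hab], ha⟩
  · rcases eq_or_lt_of_le hs.2 with rfl | h1
    · exact .inl ⟨b, by simp [hab], hb⟩
    · exact .inr ⟨h0, h1⟩

lemma exists_mem_crossings {e f : Sym2 V} (hef : ∀ v ∈ e, v ∉ f)
    (h : (D.trace e ∩ D.trace f).Nonempty) :
    ∃ c ∈ D.crossings, c.1.map Subtype.val = s(e, f) := by
  obtain ⟨p, ⟨he, s, hs, hsp⟩, hf, t, ht, htp⟩ := h
  have hmeet : ∀ v ∈ e, ∀ w ∈ f, D.vertexMap v ≠ D.vertexMap w := fun v hv w hw h =>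
    hef v hv (D.vertexMap_injective h ▸ hw)
  have hne : e ≠ f := by
    rintro rfl
    induction e with | _ a b => exact hef a (by simp) (by simp)
  rcases D.eq_vertexMap_or_mem_Ioo ⟨e, he⟩ hs with ⟨v, hv, hv'⟩ | hs <;>
    rcases D.eq_vertexMap_or_mem_Ioo ⟨f, hf⟩ ht with ⟨w, hw, hw'⟩ | ht
  · exact (hmeet v hv w hw (by rw [← hv', ← hw', hsp, htp])).elim
  · exact (D.arc_avoids_vertices _ t ht v (by rw [← hv', hsp, htp])).elim
  · exact (D.arc_avoids_vertices _ s hs w (by rw [← hw', hsp, htp])).elim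
  · exact ⟨(s(⟨e, he⟩, ⟨f, hf⟩), p), ⟨_, _, by simpa using hne, rfl, ⟨s, hs, hsp⟩, ⟨t, ht, htp⟩⟩,
      rfl⟩

end Drawing

/-- The four vertices adjacent to both `0` and `3`. -/
def strand : Fin 4 → Fin 6 := ![1, 2, 4, 5]

/-- The two centres `0` and `3` of the stars. -/
def hub (q : ℕ) : Fin 6 := if q % 3 = 0 then 0 else 3

/-- The edge in position `q` belonging to the strand `x`: a spoke of a star if `q % 3 ≠ 2`,
and an edge of a copy of the path otherwise. -/
def ladderEdge (n : ℕ) (a : Fin 4 × ℕ) : Sym2 (Fin 6 × Fin (n + 1)) :=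
  if a.2 % 3 = 2 then
    s((strand a.1, Fin.ofNat (n + 1) (a.2 / 3)), (strand a.1, Fin.ofNat (n + 1) (a.2 / 3 + 1)))
  else
    s((hub a.2, Fin.ofNat (n + 1) (a.2 / 3)), (strand a.1, Fin.ofNat (n + 1) (a.2 / 3)))

lemma strand_injective : Function.Injective strand := by decide

lemma hub_ne_strand (q : ℕ) (x : Fin 4) : hub q ≠ strand x := by
  unfold hub
  split_ifs <;> revert x <;> decide

lemma adj_hub_strand (q : ℕ) (x : Fin 4) : G6_137.Adj (hub q) (strand x) := by
  unfold hub
  split_ifs <;> fin_cases x <;> simp [G6_137, strand]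

lemma ofNat_inj {n a b : ℕ} (ha : a ≤ n) (hb : b ≤ n) :
    Fin.ofNat (n + 1) a = Fin.ofNat (n + 1) b ↔ a = b := by
  rw [Fin.ext_iff, Fin.val_ofNat, Fin.val_ofNat, Nat.mod_eq_of_lt (by omega),
    Nat.mod_eq_of_lt (by omega)]

lemma hub_inj {q q' : ℕ} (h : q % 3 ≠ 2) (h' : q' % 3 ≠ 2) :
    hub q = hub q' ↔ q % 3 = q' % 3 := by
  unfold hub
  split_ifs <;> simp <;> omega

lemma ladderEdge_injOn {n : ℕ} {a b : Fin 4 × ℕ} (ha : a.2 ≤ 3 * n + 1) (hb : b.2 ≤ 3 * n + 1)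
    (h : ladderEdge n a = ladderEdge n b) : a = b := by
  obtain ⟨x, q⟩ := a
  obtain ⟨y, q'⟩ := b
  dsimp only at ha hb
  unfold ladderEdge at h
  split_ifs at h with h1 h2 h2
  · simp (disch := omega) only [Sym2.eq_iff, Prod.mk.injEq, strand_injective.eq_iff, ofNat_inj] at h ⊢
    omega
  · simp [(hub_ne_strand _ _).symm] at h
  · simp [hub_ne_strand] at h
  · simp (disch := omega) only [Sym2.eq_iff, Prod.mk.injEq, strand_injective.eq_iff, ofNat_inj,
      hub_inj, hub_ne_strand, false_and, or_false] at h ⊢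
    omega

lemma ladderEdge_disjoint {n : ℕ} {a b : Fin 4 × ℕ} (ha : a.2 ≤ 3 * n + 1) (hb : b.2 ≤ 3 * n + 1)
    (hab : a.1 ≠ b.1) (hq : a.2 ≠ b.2) : ∀ v ∈ ladderEdge n a, v ∉ ladderEdge n b := by
  obtain ⟨x, q⟩ := a
  obtain ⟨y, q'⟩ := b
  dsimp only at ha hb hab hq
  intro v hv hv'
  unfold ladderEdge at hv hv'
  split_ifs at hv hv' <;> rw [Sym2.mem_iff] at hv hv' <;> rcases hv with rfl | rfl <;>
    rcases hv' with h | h <;>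
    simp (disch := omega) only [Prod.mk.injEq, strand_injective.eq_iff, ofNat_inj, hab,
      hub_inj, hub_ne_strand, (hub_ne_strand _ _).symm, false_and] at h
  omega

/-- The graph under consideration. -/
abbrev prism (n : ℕ) : SimpleGraph (Fin 6 × Fin (n + 1)) := G6_137 □ pathGraph (n + 1)

lemma joinedIn_star {n : ℕ} (D : Drawing (prism n)) {q : ℕ} (hq : q % 3 ≠ 2) (x : Fin 4) :
    JoinedIn (D.trace (ladderEdge n (x, q))) (D.vertexMap (hub q, Fin.ofNat (n + 1) (q / 3)))
      (D.vertexMap (strand x, Fin.ofNat (n + 1) (q / 3))) := by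
  rw [ladderEdge, if_neg hq]
  exact D.joinedIn_trace (boxProd_adj_left.mpr (adj_hub_strand q x))

lemma joinedIn_strand {n : ℕ} (D : Drawing (prism n)) {F : Set (ℝ × ℝ)} (x : Fin 4) {L M : ℕ}
    (hLM : L ≤ M) (hM : M ≤ n) (h0 : L = M → D.vertexMap (strand x, Fin.ofNat (n + 1) L) ∈ F)
    (hF : ∀ g, L ≤ g → g < M → D.trace (ladderEdge n (x, 3 * g + 2)) ⊆ F) :
    JoinedIn F (D.vertexMap (strand x, Fin.ofNat (n + 1) L))
      (D.vertexMap (strand x, Fin.ofNat (n + 1) M)) := by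
  induction M, hLM using Nat.le_induction with
  | base => exact JoinedIn.refl (h0 rfl)
  | succ M hLM ih =>
    have hstep : JoinedIn F (D.vertexMap (strand x, Fin.ofNat (n + 1) M))
        (D.vertexMap (strand x, Fin.ofNat (n + 1) (M + 1))) := by
      refine JoinedIn.mono ?_ (hF M hLM (by omega))
      have e : (3 * M + 2) / 3 = M := by omega
      rw [ladderEdge, if_pos (by dsimp only; omega)]
      dsimp only
      rw [e]
      refine D.joinedIn_trace (boxProd_adj_right.mpr (pathGraph_adj.mpr (.inl ?_)))
      rw [Fin.val_ofNat, Fin.val_ofNat, Nat.mod_eq_of_lt (by omega), Nat.mod_eq_of_lt (by omega)]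
    exact (ih (by omega) (fun e => e ▸ hstep.source_mem) fun g h h' =>
      hF g h (by omega)).trans hstep

lemma joinedIn_arm {n : ℕ} (D : Drawing (prism n)) {l p r : ℕ} (hl : l % 3 ≠ 2) (hp : p % 3 ≠ 2)
    (hr : r % 3 ≠ 2) (hlp : l < p) (hpr : p < r) (hrn : r ≤ 3 * n + 1) (i : Fin 3) (x : Fin 4) :
    JoinedIn (⋃ q ∈ arm l p r i, D.trace (ladderEdge n (x, q)))
      (D.vertexMap (hub (![l, p, r] i), Fin.ofNat (n + 1) (![l, p, r] i / 3)))
      (D.vertexMap (strand x, Fin.ofNat (n + 1) (p / 3))) := by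
  have hsub : ∀ i, ∀ q ∈ arm l p r i, D.trace (ladderEdge n (x, q)) ⊆
      ⋃ q ∈ arm l p r i, D.trace (ladderEdge n (x, q)) := fun i q hq =>
    Set.subset_biUnion_of_mem (u := fun q => D.trace (ladderEdge n (x, q))) hq
  fin_cases i
  · have h := (joinedIn_star D hl x).mono (hsub 0 l (by simp [arm]))
    refine h.trans (joinedIn_strand D x (by omega) (by omega) (fun _ => h.target_mem)
      fun g _ _ => hsub 0 _ ?_)
    simp [arm]; omega
  · exact (joinedIn_star D hp x).mono (hsub 1 p (by simp [arm]))
  · have h := (joinedIn_star D hr x).mono (hsub 2 r (by simp [arm]))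
    refine h.trans (joinedIn_strand D x (by omega) (by omega) (fun e => ?_)
      fun g _ _ => hsub 2 _ ?_).symm
    · rw [e]; exact h.target_mem
    · simp [arm]; omega

lemma starPos_mod (j : ℕ) : starPos j % 3 ≠ 2 := by
  unfold starPos; omega

theorem four_mul_le_ncard_crossings {n : ℕ} (D : Drawing (prism n)) (hD : D.crossings.Finite) :
    4 * n ≤ D.crossings.ncard := by
  classical
  let C : Fin 4 × ℕ → Fin 4 × ℕ → Prop := fun a b =>
    (D.trace (ladderEdge n a) ∩ D.trace (ladderEdge n b)).Nonempty
  let P : Finset (Fin 4 × ℕ) := Finset.univ ×ˢ Finset.range (3 * n + 2)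
  have hP : ∀ a, a ∈ P ↔ a.2 ≤ 3 * n + 1 := fun a => by simp [P]; omega
  let X := (P ×ˢ P).filter fun w => w.1.1 < w.2.1 ∧ w.1.2 ≠ w.2.2 ∧ C w.1 w.2
  have hX : 4 * n ≤ X.card := by
    refine four_mul_le_card (C := C) (fun a b ⟨p, h, h'⟩ => ⟨p, h', h⟩) ?_ ?_
    · intro t ht z
      obtain ⟨hlp, hpr⟩ := low_lt ht
      obtain ⟨i, i', j, j', hi, hj, v, hv, hv'⟩ := exists_inter_nonempty_of_joinedIn
        (fun (i j : Fin 3) => joinedIn_arm D (starPos_mod _) (starPos_mod _) (starPos_mod _)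
          hlp hpr (highPos_le ht) i (z.succAbove j))
      obtain ⟨q, hq, hv⟩ := Set.mem_iUnion₂.mp hv
      obtain ⟨q', hq', hv'⟩ := Set.mem_iUnion₂.mp hv'
      exact ⟨(z.succAbove j, q), (z.succAbove j', q'),
        fun h => hj (Fin.succAbove_right_injective h), Fin.succAbove_ne _ _, Fin.succAbove_ne _ _,
        ⟨v, hv, hv'⟩, i, i', hi, hq, hq'⟩
    · intro a b hab ha hb hq hc
      exact Finset.mem_filter.mpr ⟨Finset.mem_product.mpr ⟨(hP a).mpr ha, (hP b).mpr hb⟩,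
        hab, hq, hc⟩
  let S : Set (Sym2 (Sym2 (Fin 6 × Fin (n + 1)))) := (fun c => c.1.map Subtype.val) '' D.crossings
  have hXS : X.card ≤ S.ncard := by
    rw [← Set.ncard_coe_finset]
    refine Set.ncard_le_ncard_of_injOn (fun w => s(ladderEdge n w.1, ladderEdge n w.2)) ?_ ?_
      (hD.image _)
    · intro w hw
      obtain ⟨hw, h1, h2, h3⟩ := Finset.mem_filter.mp hw
      obtain ⟨ha, hb⟩ := Finset.mem_product.mp hw
      exact D.exists_mem_crossings (ladderEdge_disjoint ((hP _).mp ha) ((hP _).mp hb) h1.ne h2) h3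
    · intro w hw w' hw' h
      obtain ⟨hw, h1, -⟩ := Finset.mem_filter.mp hw
      obtain ⟨hw', h1', -⟩ := Finset.mem_filter.mp hw'
      simp only [Finset.mem_product, hP] at hw hw'
      rcases Sym2.eq_iff.mp h with ⟨ha, hb⟩ | ⟨ha, hb⟩
      · exact Prod.ext (ladderEdge_injOn hw.1 hw'.1 ha) (ladderEdge_injOn hw.2 hw'.2 hb)
      · rw [ladderEdge_injOn hw.1 hw'.2 ha, ladderEdge_injOn hw.2 hw'.1 hb] at h1
        exact absurd h1 h1'.asymm
  exact hX.trans (hXS.trans (Set.ncard_image_le hD))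
lemma adj_out {V : Type*} {G : SimpleGraph V} (e : G.edgeSet) :
    G.Adj (Quot.out e.1).1 (Quot.out e.1).2 := by
  have h : s((Quot.out e.1).1, (Quot.out e.1).2) = e.1 := Quot.out_eq e.1
  rw [← mem_edgeSet, h]
  exact e.2

/-- The drawing with straight edges at the given vertex positions. -/
noncomputable def straightDrawing {V : Type*} (G : SimpleGraph V) (pos : V → ℝ × ℝ)
    (hpos : Function.Injective pos)
    (havoid : ∀ u v w, G.Adj u v → pos w ∉ openSegment ℝ (pos u) (pos v)) : Drawing G where
  vertexMap := pos
  vertexMap_injective := hpos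
  arc e := AffineMap.lineMap (pos (Quot.out e.1).1) (pos (Quot.out e.1).2)
  arc_continuousOn e := AffineMap.lineMap_continuous.continuousOn
  arc_injOn e := (AffineMap.lineMap_injective ℝ (hpos.ne (adj_out e).ne)).injOn
  arc_endpoints e := ⟨(Quot.out e.1).1, (Quot.out e.1).2, (Quot.out_eq e.1).symm, by simp, by simp⟩
  arc_avoids_vertices e t ht w hw := by
    refine havoid _ _ w (adj_out e) ?_
    rw [openSegment_eq_image_lineMap]
    exact ⟨t, ht, hw⟩

lemma mem_crossings_straightDrawing {V : Type*} {G : SimpleGraph V} {pos : V → ℝ × ℝ}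
    {hpos : Function.Injective pos}
    {havoid : ∀ u v w, G.Adj u v → pos w ∉ openSegment ℝ (pos u) (pos v)}
    {c : Sym2 G.edgeSet × (ℝ × ℝ)} (hc : c ∈ (straightDrawing G pos hpos havoid).crossings) :
    ∃ u v u' v', G.Adj u v ∧ G.Adj u' v' ∧ s(u, v) ≠ s(u', v') ∧
      c.1.map Subtype.val = s(s(u, v), s(u', v')) ∧ c.2 ∈ openSegment ℝ (pos u) (pos v) ∧
      c.2 ∈ openSegment ℝ (pos u') (pos v') := by
  obtain ⟨e, f, hef, hc, hs, ht⟩ := hc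
  have he : s((Quot.out e.1).1, (Quot.out e.1).2) = e.1 := Quot.out_eq e.1
  have hf : s((Quot.out f.1).1, (Quot.out f.1).2) = f.1 := Quot.out_eq f.1
  refine ⟨_, _, _, _, adj_out e, adj_out f, ?_, ?_, ?_, ?_⟩
  · rw [he, hf]
    exact Subtype.val_injective.ne hef
  · rw [he, hf, hc]
    rfl
  · rw [openSegment_eq_image_lineMap]
    exact hs
  · rw [openSegment_eq_image_lineMap]
    exact ht

/-- Vertex positions for a planar straight-line drawing of `G6_137`. -/
def shape : Fin 6 → ℝ × ℝ := ![(3, 0), (1, 1), (0, 3), (-3, 0), (0, -3), (1, -1)]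

/-- The first endpoint of the `k`-th edge of `G6_137`. -/
def src : Fin 10 → Fin 6 := ![0, 1, 2, 3, 4, 5, 0, 0, 1, 3]

/-- The second endpoint of the `k`-th edge of `G6_137`. -/
def tgt : Fin 10 → Fin 6 := ![1, 2, 3, 4, 5, 0, 2, 4, 3, 5]

/-- The chord crossed by the ray through the vertex `strand x`, as an index for `src`
and `tgt`. -/
def chord : Fin 4 → Fin 10 := ![6, 8, 9, 7]

/-- The position at which the ray through the vertex `strand x` crosses a chord. -/
noncomputable def ratio : Fin 4 → ℝ := ![3 / 2, 1 / 4, 1 / 4, 3 / 2]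

lemma shape_norm {k : Fin 10} {z : ℝ × ℝ}
    (hz : z ∈ openSegment ℝ (shape (src k)) (shape (tgt k))) :
    3 / 4 ≤ |z.1| + |z.2| ∧ |z.1| + |z.2| ≤ 3 := by
  obtain ⟨a, b, ha, hb, hab, rfl⟩ := hz
  obtain rfl : a = 1 - b := by linarith
  fin_cases k <;> simp [shape, src, tgt] <;> constructor <;> grind

lemma shape_disjoint {k k' : Fin 10} (h : k ≠ k') {z : ℝ × ℝ}
    (hz : z ∈ openSegment ℝ (shape (src k)) (shape (tgt k))) :
    z ∉ openSegment ℝ (shape (src k')) (shape (tgt k')) := by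
  obtain ⟨a, b, ha, hb, hab, rfl⟩ := hz
  rintro ⟨c, d, hc, hd, hcd, h'⟩
  obtain rfl : a = 1 - b := by linarith
  obtain rfl : c = 1 - d := by linarith
  rw [Prod.ext_iff] at h'
  obtain ⟨h1, h2⟩ := h'
  fin_cases k <;> fin_cases k' <;> simp [shape, src, tgt] at h h1 h2 <;> linarith

lemma shape_ray {k : Fin 10} {v : Fin 6} {c : ℝ} (hc : 0 < c)
    (hz : c • shape v ∈ openSegment ℝ (shape (src k)) (shape (tgt k))) :
    ∃ x, v = strand x ∧ k = chord x ∧ c = ratio x := by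
  obtain ⟨a, b, ha, hb, hab, h⟩ := hz
  obtain rfl : a = 1 - b := by linarith
  rw [Prod.ext_iff] at h
  obtain ⟨h1, h2⟩ := h
  by_cases hx : ∃ x, v = strand x ∧ k = chord x
  · obtain ⟨x, rfl, rfl⟩ := hx
    refine ⟨x, rfl, rfl, ?_⟩
    fin_cases x <;> simp [shape, src, tgt, strand, chord, ratio] at h1 h2 ⊢ <;> linarith
  · exfalso
    fin_cases k <;> fin_cases v <;>
    first
    | exact hx (by decide)
    | (clear hx; simp [shape, src, tgt] at h1 h2; linarith)

lemma shape_ray_inj {v w : Fin 6} {c d : ℝ} (hc : 0 < c) (hd : 0 < d)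
    (h : c • shape v = d • shape w) : v = w ∧ c = d := by
  rw [Prod.ext_iff] at h
  obtain ⟨h1, h2⟩ := h
  fin_cases v <;> fin_cases w <;> simp [shape] at h1 h2 ⊢ <;> linarith

/-- The vertex positions of `prism n`: concentric copies of `shape`, scaled by powers of `8`. -/
noncomputable def position {n : ℕ} (p : Fin 6 × Fin (n + 1)) : ℝ × ℝ :=
  (8 : ℝ) ^ (p.2 : ℕ) • shape p.1

/-- The `k`-th edge of the `L`-th copy of `G6_137`. -/
def levelEdge (n : ℕ) (k : Fin 10) (L : ℕ) : Sym2 (Fin 6 × Fin (n + 1)) :=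
  s((src k, Fin.ofNat (n + 1) L), (tgt k, Fin.ofNat (n + 1) L))

/-- The `M`-th edge of the copy of the path at `v`. -/
def columnEdge (n : ℕ) (v : Fin 6) (M : ℕ) : Sym2 (Fin 6 × Fin (n + 1)) :=
  s((v, Fin.ofNat (n + 1) M), (v, Fin.ofNat (n + 1) (M + 1)))

lemma exists_src_tgt {a b : Fin 6} (h : G6_137.Adj a b) : ∃ k, s(a, b) = s(src k, tgt k) := by
  obtain ⟨h | h | h | h | h | h | h | h | h | h, -⟩ := h
  exacts [⟨0, h⟩, ⟨1, h⟩, ⟨2, h⟩, ⟨3, h⟩, ⟨4, h⟩, ⟨5, h⟩, ⟨6, h⟩, ⟨7, h⟩, ⟨8, h⟩, ⟨9, h⟩]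

lemma mem_openSegment_succ {n : ℕ} {v : Fin 6} {i j : Fin (n + 1)} (hij : (i : ℕ) + 1 = j)
    {z : ℝ × ℝ} (hz : z ∈ openSegment ℝ (position (v, i)) (position (v, j))) :
    ∃ c : ℝ, 8 ^ (i : ℕ) < c ∧ c < 8 ^ ((i : ℕ) + 1) ∧ z = c • shape v := by
  obtain ⟨a, b, ha, hb, hab, rfl⟩ := hz
  obtain rfl : a = 1 - b := by linarith
  have h8 : (0 : ℝ) < 8 ^ (i : ℕ) := by positivity
  refine ⟨(1 - b) * 8 ^ (i : ℕ) + b * 8 ^ ((i : ℕ) + 1), ?_, ?_, ?_⟩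
  · rw [pow_succ]
    nlinarith
  · rw [pow_succ]
    nlinarith
  · rw [add_smul, mul_smul, mul_smul, hij]
    rfl

lemma mem_openSegment_position {n : ℕ} {u v : Fin 6 × Fin (n + 1)} (h : (prism n).Adj u v)
    {z : ℝ × ℝ} (hz : z ∈ openSegment ℝ (position u) (position v)) :
    (∃ k L, s(u, v) = levelEdge n k L ∧
      ∃ y ∈ openSegment ℝ (shape (src k)) (shape (tgt k)), z = (8 : ℝ) ^ L • y) ∨
    ∃ w, ∃ M < n, s(u, v) = columnEdge n w M ∧
      ∃ c : ℝ, 8 ^ M < c ∧ c < 8 ^ (M + 1) ∧ z = c • shape w := by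
  obtain ⟨a, i⟩ := u
  obtain ⟨b, j⟩ := v
  rcases boxProd_adj.mp h with ⟨h, hij⟩ | ⟨h, hab⟩
  · obtain rfl : i = j := hij
    obtain ⟨k, hk⟩ := exists_src_tgt h
    have hz' : z ∈ openSegment ℝ ((8 : ℝ) ^ (i : ℕ) • shape (src k))
        ((8 : ℝ) ^ (i : ℕ) • shape (tgt k)) := by
      rcases Sym2.eq_iff.mp hk with ⟨h₁, h₂⟩ | ⟨h₁, h₂⟩
      · rw [← h₁, ← h₂]
        exact hz
      · rw [← h₁, ← h₂, openSegment_symm]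
        exact hz
    refine .inl ⟨k, i, ?_, ?_⟩
    · have := congrArg (Sym2.map (·, i)) hk
      simpa [levelEdge] using this
    · obtain ⟨c, d, hc, hd, hcd, rfl⟩ := hz'
      exact ⟨_, ⟨c, d, hc, hd, hcd, rfl⟩, by
        rw [smul_add, smul_comm c, smul_comm d]⟩
  · obtain rfl : a = b := hab
    rw [pathGraph_adj] at h
    dsimp only at h
    rcases h with hij | hij
    · refine .inr ⟨a, i, by omega, ?_, mem_openSegment_succ hij hz⟩
      have hj : Fin.ofNat (n + 1) (i + 1) = j := by simp [hij]
      rw [columnEdge, hj, Fin.ofNat_eq_cast, Fin.cast_val_eq_self]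
    · rw [openSegment_symm] at hz
      refine .inr ⟨a, j, by omega, ?_, mem_openSegment_succ hij hz⟩
      have hj : Fin.ofNat (n + 1) (j + 1) = i := by simp [hij]
      rw [columnEdge, hj, Fin.ofNat_eq_cast, Fin.cast_val_eq_self, Sym2.eq_swap]

lemma level_eq_of_smul_eq {k k' : Fin 10} {L L' : ℕ} {y y' : ℝ × ℝ}
    (hy : y ∈ openSegment ℝ (shape (src k)) (shape (tgt k)))
    (hy' : y' ∈ openSegment ℝ (shape (src k')) (shape (tgt k')))
    (h : (8 : ℝ) ^ L • y = (8 : ℝ) ^ L' • y') : L = L' := by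
  wlog hlt : L < L' generalizing k k' L L' y y'
  · rcases (not_lt.mp hlt).eq_or_lt with h' | h'
    · exact h'.symm
    · exact (this hy' hy h.symm h').symm
  exfalso
  have hnorm : ∀ (m : ℕ) (z : ℝ × ℝ),
      |((8 : ℝ) ^ m • z).1| + |((8 : ℝ) ^ m • z).2| = 8 ^ m * (|z.1| + |z.2|) := by
    intro m z
    simp [abs_mul, mul_add]
  have h1 := hnorm L y
  rw [h, hnorm L' y'] at h1
  have hle : (8 : ℝ) ^ (L + 1) ≤ 8 ^ L' := pow_le_pow_right₀ (by norm_num) hlt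
  have h8 : (0 : ℝ) < 8 ^ L := by positivity
  rw [pow_succ] at hle
  nlinarith [(shape_norm hy).2, (shape_norm hy').1]

/-- The level of the chord crossed by the edges of the path at `strand x`, relative to
the lower end of the edge. -/
def offset : Fin 4 → ℕ := ![0, 1, 1, 0]

lemma add_offset_le {x : Fin 4} {L M : ℕ} (h : 8 ^ M ≤ 8 ^ L * ratio x) :
    M + offset x ≤ L := by
  by_contra! hlt
  have hle : (8 : ℝ) ^ (L + 1) ≤ 8 ^ (M + offset x) := pow_le_pow_right₀ (by norm_num) hlt
  have h8 : (0 : ℝ) < 8 ^ L := by positivity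
  fin_cases x <;> simp [ratio, offset, pow_succ] at hle h <;> linarith

lemma lt_add_offset {x : Fin 4} {L M : ℕ} (h : 8 ^ L * ratio x ≤ 8 ^ M) :
    L < M + offset x := by
  by_contra! hle
  have : (8 : ℝ) ^ (M + offset x) ≤ 8 ^ L := pow_le_pow_right₀ (by norm_num) hle
  have h8 : (0 : ℝ) < 8 ^ M := by positivity
  fin_cases x <;> simp [ratio, offset, pow_succ] at this h <;> linarith

lemma eq_strand_of_smul_eq {k : Fin 10} {L : ℕ} {v : Fin 6} {c : ℝ} {y : ℝ × ℝ} (hc : 0 < c)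
    (hy : y ∈ openSegment ℝ (shape (src k)) (shape (tgt k))) (h : c • shape v = (8 : ℝ) ^ L • y) :
    ∃ x, v = strand x ∧ k = chord x ∧ c = 8 ^ L * ratio x := by
  have h8 : (0 : ℝ) < 8 ^ L := by positivity
  obtain rfl : (c / 8 ^ L) • shape v = y := by
    rw [div_eq_inv_mul, mul_smul, h, inv_smul_smul₀ h8.ne']
  obtain ⟨x, hv, hk, hx⟩ := shape_ray (by positivity) hy
  exact ⟨x, hv, hk, by rw [← hx, mul_div_cancel₀ _ h8.ne']⟩

lemma position_injective (n : ℕ) : Function.Injective (position (n := n)) := by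
  intro u v h
  obtain ⟨h₁, h₂⟩ := shape_ray_inj (by positivity) (by positivity) h
  exact Prod.ext h₁ (Fin.ext (pow_right_injective₀ (by norm_num) (by norm_num) h₂))

lemma position_notMem_openSegment {n : ℕ} (u v w : Fin 6 × Fin (n + 1)) (h : (prism n).Adj u v) :
    position w ∉ openSegment ℝ (position u) (position v) := by
  intro hw
  rcases mem_openSegment_position h hw with ⟨k, L, -, y, hy, hz⟩ | ⟨x, M, -, -, c, hc, hc', hz⟩
  · obtain ⟨x, -, -, hx⟩ := eq_strand_of_smul_eq (by positivity) hy hz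
    have := add_offset_le hx.le
    have := lt_add_offset hx.ge
    omega
  · have hc₀ : 0 < c := hc.trans' (by positivity)
    obtain ⟨-, rfl⟩ := shape_ray_inj (by positivity) hc₀ hz
    rw [pow_lt_pow_iff_right₀ (by norm_num)] at hc hc'
    omega

/-- The crossings of the drawing, with edges regarded as unordered pairs of vertices. -/
noncomputable def drawnCrossing (n : ℕ) (a : Fin 4 × Fin n) :
    Sym2 (Sym2 (Fin 6 × Fin (n + 1))) × (ℝ × ℝ) :=
  (s(levelEdge n (chord a.1) (a.2 + offset a.1), columnEdge n (strand a.1) a.2),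
    ((8 : ℝ) ^ (a.2 + offset a.1) * ratio a.1) • shape (strand a.1))

lemma mk_mem_range_drawnCrossing {n : ℕ} {k : Fin 10} {L M : ℕ} {v : Fin 6} {c : ℝ}
    {y z : ℝ × ℝ} (hM : M < n) (hy : y ∈ openSegment ℝ (shape (src k)) (shape (tgt k)))
    (hz : z = (8 : ℝ) ^ L • y) (hc : 8 ^ M < c) (hc' : c < 8 ^ (M + 1)) (hz' : z = c • shape v) :
    (s(levelEdge n k L, columnEdge n v M), z) ∈ Set.range (drawnCrossing n) := by
  have hc₀ : 0 < c := hc.trans' (by positivity)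
  obtain ⟨x, rfl, rfl, rfl⟩ := eq_strand_of_smul_eq hc₀ hy (hz' ▸ hz)
  have h₁ := add_offset_le hc.le
  have h₂ := lt_add_offset hc'.le
  obtain rfl : L = M + offset x := by omega
  exact ⟨(x, ⟨M, hM⟩), by rw [hz']; rfl⟩

/-- The straight-line drawing of `prism n` with vertices at `position`. -/
noncomputable def prismDrawing (n : ℕ) : Drawing (prism n) :=
  straightDrawing _ position (position_injective n) position_notMem_openSegment

lemma mapsTo_crossings_prismDrawing (n : ℕ) :
    Set.MapsTo (Prod.map (Sym2.map Subtype.val) id) (prismDrawing n).crossings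
      (Set.range (drawnCrossing n)) := by
  intro c hc
  obtain ⟨u, v, u', v', h, h', hne, hcm, hz, hz'⟩ := mem_crossings_straightDrawing hc
  have hmap : Prod.map (Sym2.map Subtype.val) id c = (s(s(u, v), s(u', v')), c.2) :=
    Prod.ext hcm rfl
  rw [hmap]
  rcases mem_openSegment_position h hz with ⟨k, L, he, y, hy, hz⟩ | ⟨w, M, hM, he, a, ha, ha', hz⟩ <;>
  rcases mem_openSegment_position h' hz' with
    ⟨k', L', he', y', hy', hz'⟩ | ⟨w', M', hM', he', b, hb, hb', hz'⟩ <;>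
  rw [he, he'] at hne ⊢
  · obtain rfl := level_eq_of_smul_eq hy hy' (hz ▸ hz')
    obtain rfl : y = y' := smul_right_injective _ (by positivity) (hz ▸ hz')
    by_cases hk : k = k'
    · exact absurd (by rw [hk]) hne
    · exact absurd hy' (shape_disjoint hk hy)
  · exact mk_mem_range_drawnCrossing hM' hy hz hb hb' hz'
  · rw [Sym2.eq_swap]
    exact mk_mem_range_drawnCrossing hM hy' hz' ha ha' hz
  · have ha₀ : 0 < a := ha.trans' (by positivity)
    have hb₀ : 0 < b := hb.trans' (by positivity)
    obtain ⟨rfl, rfl⟩ := shape_ray_inj ha₀ hb₀ (hz ▸ hz')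
    have h₁ := ha.trans hb'
    have h₂ := hb.trans ha'
    rw [pow_lt_pow_iff_right₀ (by norm_num)] at h₁ h₂
    obtain rfl : M = M' := by omega
    exact absurd rfl hne

lemma injective_prodMap_sym2Map {V : Type*} {G : SimpleGraph V} :
    Function.Injective (Prod.map (Sym2.map Subtype.val) id :
      Sym2 G.edgeSet × (ℝ × ℝ) → Sym2 (Sym2 V) × (ℝ × ℝ)) :=
  (Sym2.map.injective Subtype.val_injective).prodMap Function.injective_id

lemma finite_crossings_prismDrawing (n : ℕ) : (prismDrawing n).crossings.Finite :=
  .of_injOn (mapsTo_crossings_prismDrawing n) injective_prodMap_sym2Map.injOn (Set.finite_range _)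

lemma ncard_crossings_prismDrawing_le (n : ℕ) : (prismDrawing n).crossings.ncard ≤ 4 * n := by
  refine (Set.ncard_le_ncard_of_injOn _ (mapsTo_crossings_prismDrawing n)
    injective_prodMap_sym2Map.injOn (Set.finite_range _)).trans ?_
  rw [← Set.image_univ]
  refine (Set.ncard_image_le Set.finite_univ).trans ?_
  simp [Set.ncard_univ]

/-- The crossing number of `G⁶₁₃₇ □ Pₙ` is `4n` for all `n ≥ 1`. -/
theorem crossingNumber_G6_137_boxProd_path (n : ℕ) (hn : 1 ≤ n) :
    crossingNumber (G6_137 □ SimpleGraph.pathGraph (n + 1)) = 4 * n := by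
  refine le_antisymm ?_ ?_
  · refine (Nat.sInf_le ?_).trans (ncard_crossings_prismDrawing_le n)
    exact ⟨prismDrawing n, finite_crossings_prismDrawing n, rfl⟩
  · refine le_csInf ⟨_, prismDrawing n, finite_crossings_prismDrawing n, rfl⟩ ?_
    rintro _ ⟨D, hD, rfl⟩
    exact four_mul_le_ncard_crossings D hD
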